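/- For every set X of infinite binary sequences, cdim(X) = inf G_constr(X); that is, the infimum over all s for which some constructive s-supergale succeeds on all of X equals the infimum over all s for which some constructive s-gale succeeds on all of X. -/

import Mathlib

open Filter

/-- The length-`n` prefix `S[0..n-1]` of an infinite binary sequence `S`. -/
def preSeq (S : ℕ → Bool) (n : ℕ) : List Bool := (List.range n).map S

/-- An `s`-supergale: a nonnegative function on binary strings with
    `d w ≥ (d w0 + d w1) / 2^s`. -/
def Supergale (s : ℝ) (d : List Bool → ℝ) : Prop :=
  (∀ w, 0 ≤ d w) ∧
  ∀ w : List Bool, (d (w ++ [false]) + d (w ++ [true])) / 2 ^ s ≤ d w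

/-- An `s`-gale: a nonnegative function on binary strings with
    `d w = (d w0 + d w1) / 2^s`. -/
def Gale (s : ℝ) (d : List Bool → ℝ) : Prop :=
  (∀ w, 0 ≤ d w) ∧
  ∀ w : List Bool, d w = (d (w ++ [false]) + d (w ++ [true])) / 2 ^ s

/-- The success set `S∞[d]`: the sequences on whose prefixes `d` has limsup `∞`. -/
def SuccessSet (d : List Bool → ℝ) : Set (ℕ → Bool) :=
  {S | limsup (fun n => ((d (preSeq S n) : ℝ) : EReal)) atTop = ⊤}

/-- A real number is computable if some computable rational sequence
    approximates it to within `2 ^ (-n)`. -/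
def ComputableReal (r : ℝ) : Prop :=
  ∃ f : ℕ → ℚ, Computable f ∧ ∀ n : ℕ, |(f n : ℝ) - r| ≤ 2 ^ (-(n : ℝ))

/-- A function on binary strings is constructive if it is approximable from
    below by a computable rational function, nondecreasing and strictly below
    `g` in its second argument, with supremum `g w`. -/
def Constructive (g : List Bool → ℝ) : Prop :=
  ∃ h : List Bool × ℕ → ℚ, Computable h ∧
    (∀ w n, h (w, n) ≤ h (w, n + 1) ∧ ((h (w, n) : ℝ) < g w)) ∧
    ∀ w, g w = ⨆ n : ℕ, ((h (w, n) : ℝ))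

theorem preSeq_succ (S : ℕ → Bool) (n : ℕ) : preSeq S (n + 1) = preSeq S n ++ [S n] := by
  simp [preSeq, List.range_succ]

theorem length_preSeq (S : ℕ → Bool) (n : ℕ) : (preSeq S n).length = n := by
  simp [preSeq]

/-- The infinite sequence obtained by appending zeros to a string. -/
def zeroExt (v : List Bool) (i : ℕ) : Bool := v.getD i false

theorem preSeq_zeroExt (v : List Bool) : preSeq (zeroExt v) v.length = v := by
  refine List.ext_getElem (length_preSeq _ _) fun i h1 h2 => ?_
  simp [preSeq, zeroExt, h2]

theorem preSeq_eq_concat_iff (S : ℕ → Bool) (w : List Bool) (a : Bool) :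
    preSeq S (w ++ [a]).length = w ++ [a] ↔ preSeq S w.length = w ∧ S w.length = a := by
  rw [List.length_append, List.length_singleton, preSeq_succ]
  simp

/-- The gale with growth factor `c` that is induced by the measure putting mass `ω v` on the
sequence `v000...`. -/
noncomputable def massGale (c : ℝ) (ω : List Bool → ℝ) (w : List Bool) : ℝ :=
  c ^ w.length * ∑' v, if preSeq (zeroExt v) w.length = w then ω v else 0

section massGale

variable {c : ℝ} {ω : List Bool → ℝ}

theorem summable_ite_of_nonneg (h0 : ∀ v, 0 ≤ ω v) (hω : Summable ω) (p : List Bool → Prop)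
    [DecidablePred p] : Summable fun v => if p v then ω v else 0 :=
  hω.of_nonneg_of_le (fun v => by split_ifs <;> simp [h0]) fun v => by split_ifs <;> simp [h0]

theorem gale_massGale (hc : 0 < c) (h0 : ∀ v, 0 ≤ ω v) (hω : Summable ω) :
    Gale (Real.logb 2 c) (massGale c ω) := by
  refine ⟨fun w => mul_nonneg (by positivity)
    (tsum_nonneg fun v => by split_ifs <;> simp [h0]), fun w => ?_⟩
  have hsplit : (∑' v, if preSeq (zeroExt v) w.length = w then ω v else 0) =
      (∑' v, if preSeq (zeroExt v) (w ++ [false]).length = w ++ [false] then ω v else 0) +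
      ∑' v, if preSeq (zeroExt v) (w ++ [true]).length = w ++ [true] then ω v else 0 := by
    rw [← (summable_ite_of_nonneg h0 hω _).tsum_add (summable_ite_of_nonneg h0 hω _)]
    refine tsum_congr fun v => ?_
    simp only [preSeq_eq_concat_iff]
    cases zeroExt v w.length <;> simp
  rw [Real.rpow_logb (by norm_num) (by norm_num) hc, eq_div_iff hc.ne']
  simp only [massGale]
  rw [hsplit]
  simp only [List.length_append, List.length_singleton]
  ring

theorem le_massGale (hc : 0 < c) (h0 : ∀ v, 0 ≤ ω v) (hω : Summable ω) (v : List Bool) :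
    c ^ v.length * ω v ≤ massGale c ω v := by
  refine mul_le_mul_of_nonneg_left ?_ (by positivity)
  have := (summable_ite_of_nonneg h0 hω fun u => preSeq (zeroExt u) v.length = v).le_tsum v
    fun u _ => by split_ifs <;> simp [h0]
  simpa [preSeq_zeroExt] using this

end massGale

/-- The finite set of strings of length `n`. -/
def stringsOfLength : ℕ → Finset (List Bool)
  | 0 => {[]}
  | n + 1 => (stringsOfLength n).image (· ++ [false]) ∪ (stringsOfLength n).image (· ++ [true])

theorem mem_stringsOfLength (v : List Bool) : v ∈ stringsOfLength v.length := by
  induction v using List.reverseRecOn with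
  | nil => simp [stringsOfLength]
  | append_singleton v a ih =>
    rw [List.length_append, List.length_singleton, stringsOfLength]
    cases a <;> simp [ih]

theorem length_of_mem_stringsOfLength {n : ℕ} {v : List Bool} (h : v ∈ stringsOfLength n) :
    v.length = n := by
  induction n generalizing v with
  | zero => simpa [stringsOfLength] using h
  | succ n ih =>
    simp only [stringsOfLength, Finset.mem_union, Finset.mem_image] at h
    rcases h with ⟨u, hu, rfl⟩ | ⟨u, hu, rfl⟩ <;> simp [ih hu]

theorem Supergale.sum_stringsOfLength_le {s : ℝ} {d : List Bool → ℝ} (hd : Supergale s d)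
    (n : ℕ) : ∑ v ∈ stringsOfLength n, d v ≤ ((2 : ℝ) ^ s) ^ n * d [] := by
  induction n with
  | zero => simp [stringsOfLength]
  | succ n ih =>
    have h2 : (0 : ℝ) < 2 ^ s := by positivity
    calc ∑ v ∈ stringsOfLength (n + 1), d v
        ≤ ∑ v ∈ (stringsOfLength n).image (· ++ [false]), d v +
          ∑ v ∈ (stringsOfLength n).image (· ++ [true]), d v := by
          rw [← Finset.sum_union_inter]
          exact le_add_of_nonneg_right (Finset.sum_nonneg fun v _ => hd.1 v)
      _ = ∑ v ∈ stringsOfLength n, (d (v ++ [false]) + d (v ++ [true])) := by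
          rw [Finset.sum_image (by simp), Finset.sum_image (by simp), Finset.sum_add_distrib]
      _ ≤ ∑ v ∈ stringsOfLength n, 2 ^ s * d v := by
          refine Finset.sum_le_sum fun v _ => ?_
          have := (div_le_iff₀ h2).1 (hd.2 v)
          linarith
      _ ≤ ((2 : ℝ) ^ s) ^ (n + 1) * d [] := by
          rw [← Finset.mul_sum, pow_succ', mul_assoc]
          exact mul_le_mul_of_nonneg_left ih h2.le

/-- A Kraft-type inequality for supergales. -/
theorem Supergale.summable_div_pow {s b : ℝ} {d : List Bool → ℝ} (hd : Supergale s d)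
    (hb : (2 : ℝ) ^ s < b) : Summable fun v => d v / b ^ v.length := by
  have h2 : (0 : ℝ) < 2 ^ s := by positivity
  have hb0 : 0 < b := h2.trans hb
  have hgeo : Summable fun n : ℕ => ((2 : ℝ) ^ s / b) ^ n * d [] :=
    (summable_geometric_of_lt_one (by positivity) ((div_lt_one hb0).2 hb)).mul_right _
  have hnn : ∀ v, 0 ≤ d v / b ^ v.length := fun v => div_nonneg (hd.1 v) (by positivity)
  refine summable_of_sum_le hnn (c := ∑' n : ℕ, ((2 : ℝ) ^ s / b) ^ n * d []) fun T => ?_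
  calc ∑ v ∈ T, d v / b ^ v.length
      ≤ ∑ v ∈ (T.image List.length).biUnion stringsOfLength, d v / b ^ v.length :=
        Finset.sum_le_sum_of_subset_of_nonneg
          (fun v hv => Finset.mem_biUnion.2
            ⟨v.length, Finset.mem_image_of_mem _ hv, mem_stringsOfLength v⟩) fun v _ _ => hnn v
    _ = ∑ n ∈ T.image List.length, ∑ v ∈ stringsOfLength n, d v / b ^ v.length := by
        refine Finset.sum_biUnion fun m _ n _ hmn => Finset.disjoint_left.2 fun v hm hn => hmn ?_
        rw [← length_of_mem_stringsOfLength hm, length_of_mem_stringsOfLength hn]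
    _ ≤ ∑ n ∈ T.image List.length, ((2 : ℝ) ^ s / b) ^ n * d [] := by
        refine Finset.sum_le_sum fun n _ => ?_
        rw [Finset.sum_congr rfl fun v hv => by rw [length_of_mem_stringsOfLength hv],
          ← Finset.sum_div, div_pow, div_mul_eq_mul_div]
        gcongr
        exact hd.sum_stringsOfLength_le n
    _ ≤ ∑' n : ℕ, ((2 : ℝ) ^ s / b) ^ n * d [] :=
        hgeo.sum_le_tsum _ fun n _ => mul_nonneg (by positivity) (hd.1 [])

theorem successSet_massGale {b c : ℝ} (hb : 0 < b) (hbc : b < c) {ω d : List Bool → ℝ}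
    (h0 : ∀ v, 0 ≤ ω v) (hω : Summable ω) (h : ∀ v, 1 < d v → ω v = (b ^ v.length)⁻¹) :
    SuccessSet d ⊆ SuccessSet (massGale c ω) := by
  intro S hS
  have hS' : limsup (fun n => ((d (preSeq S n) : ℝ) : EReal)) atTop = ⊤ := hS
  have hfreq : ∃ᶠ n in atTop, ((1 : ℝ) : EReal) < ((d (preSeq S n) : ℝ) : EReal) :=
    frequently_lt_of_lt_limsup (by isBoundedDefault) (by rw [hS']; exact EReal.coe_lt_top 1)
  refine EReal.eq_top_iff_forall_lt _ |>.2 fun M => ?_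
  have hev : ∀ᶠ n : ℕ in atTop, M + 1 < (c / b) ^ n :=
    (tendsto_pow_atTop_atTop_of_one_lt ((one_lt_div hb).2 hbc)).eventually_gt_atTop _
  refine lt_of_lt_of_le (EReal.coe_lt_coe_iff.2 (lt_add_one M)) ?_
  refine le_limsup_of_frequently_le ((hfreq.and_eventually hev).mono fun n hn => ?_)
    (by isBoundedDefault)
  refine EReal.coe_le_coe_iff.2 (hn.2.le.trans ?_)
  have := le_massGale (hb.trans hbc) h0 hω (preSeq S n)
  rwa [h _ (EReal.coe_lt_coe_iff.1 hn.1), length_preSeq, ← div_eq_mul_inv, ← div_pow] at this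

theorem primrec_gcd : Primrec₂ Nat.gcd := by
  have hdvd : PrimrecRel fun (a b : ℕ) => a ∣ b :=
    (Primrec.eq.comp (Primrec.nat_mod.comp Primrec.snd Primrec.fst) (Primrec.const 0)).of_eq
      fun p => (Nat.dvd_iff_mod_eq_zero).symm
  have hrel : PrimrecRel fun (p : ℕ × ℕ) (d : ℕ) => d ∣ p.1 ∧ d ∣ p.2 :=
    PrimrecPred.and (hdvd.comp Primrec.snd (Primrec.fst.comp Primrec.fst))
      (hdvd.comp Primrec.snd (Primrec.snd.comp Primrec.fst))
  refine (Primrec.nat_findGreatest (f := fun p : ℕ × ℕ => p.1 + p.2)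
    (Primrec.nat_add.comp Primrec.fst Primrec.snd) hrel).of_eq fun p => ?_
  obtain ⟨x, y⟩ := p
  refine le_antisymm ?_ ?_
  · rcases Nat.eq_zero_or_pos (Nat.gcd x y) with h | h
    · obtain ⟨rfl, rfl⟩ := Nat.gcd_eq_zero_iff.1 h
      simp
    · have := Nat.findGreatest_spec (P := fun d => d ∣ x ∧ d ∣ y) (n := x + y) (m := 1)
        (by rcases x with - | x <;> rcases y with - | y <;> (simp at h ⊢; try omega)) (by simp)
      exact Nat.le_of_dvd h (Nat.dvd_gcd this.1 this.2)
  · refine Nat.le_findGreatest ?_ ⟨Nat.gcd_dvd_left x y, Nat.gcd_dvd_right x y⟩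
    rcases Nat.eq_zero_or_pos x with h | h
    · simp [h]
    · exact (Nat.gcd_le_left y h).trans (Nat.le_add_right x y)

theorem encode_natAbs_le (i : ℤ) : (Encodable.encode i + 1) / 2 = i.natAbs := by
  cases i with
  | ofNat n => change (2 * n + 1) / 2 = n; omega
  | negSucc n => change (2 * n + 1 + 1) / 2 = n + 1; omega

theorem mem_range_encode_rat (m : ℕ) :
    m ∈ Set.range (@Encodable.encode ℚ Rat.instEncodable) ↔
      0 < m.unpair.2 ∧ Nat.gcd ((m.unpair.1 + 1) / 2) m.unpair.2 = 1 := by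
  constructor
  · rintro ⟨q, rfl⟩
    have : (@Encodable.encode ℚ Rat.instEncodable q) = Nat.pair (Encodable.encode q.num) q.den := rfl
    rw [this, Nat.unpair_pair, encode_natAbs_le]
    exact ⟨q.pos, q.reduced⟩
  · rintro ⟨h1, h2⟩
    have hi : Encodable.encode (Denumerable.ofNat ℤ m.unpair.1) = m.unpair.1 :=
      Denumerable.encode_ofNat _
    refine ⟨⟨Denumerable.ofNat ℤ m.unpair.1, m.unpair.2, h1.ne', ?_⟩, ?_⟩
    · rw [← encode_natAbs_le, hi]
      exact h2
    · change Nat.pair (Encodable.encode (Denumerable.ofNat ℤ m.unpair.1)) m.unpair.2 = m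
      rw [hi, Nat.pair_unpair]

theorem encode_rat_eq (q : ℚ) :
    @Encodable.encode ℚ Primcodable.toEncodable q =
      ((List.range (Nat.pair (Encodable.encode q.num) q.den)).filter
        fun m => 0 < m.unpair.2 ∧ Nat.gcd ((m.unpair.1 + 1) / 2) m.unpair.2 = 1).length := by
  have h : @Encodable.encode ℚ Primcodable.toEncodable q =
      (letI := Encodable.decidableRangeEncode ℚ
       (List.range (@Encodable.encode ℚ Rat.instEncodable q)).countP
        (· ∈ Set.range (@Encodable.encode ℚ Rat.instEncodable))) := rfl
  rw [h, List.countP_eq_length_filter]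
  congr 2
  ext m
  rw [decide_eq_decide]
  exact mem_range_encode_rat m

theorem encode_num_sub_div (a b k : ℕ) :
    Nat.pair (Encodable.encode (((a : ℚ) - b) / (k + 1)).num) (((a : ℚ) - b) / (k + 1)).den =
      if b ≤ a then
        Nat.pair (2 * ((a - b) / Nat.gcd (a - b) (k + 1))) ((k + 1) / Nat.gcd (a - b) (k + 1))
      else
        Nat.pair (2 * ((b - a) / Nat.gcd (b - a) (k + 1)) - 1)
          ((k + 1) / Nat.gcd (b - a) (k + 1)) := by
  have key : ∀ x : ℕ, ((x : ℚ) / (k + 1)).num = (x / Nat.gcd x (k + 1) : ℕ) ∧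
      ((x : ℚ) / (k + 1)).den = (k + 1) / Nat.gcd x (k + 1) := by
    intro x
    have hg : 0 < Nat.gcd x (k + 1) := Nat.gcd_pos_of_pos_right _ (by omega)
    have hx : ((x / Nat.gcd x (k + 1) : ℕ) : ℤ).natAbs.Coprime
        (((k + 1) / Nat.gcd x (k + 1) : ℕ) : ℤ).natAbs := Nat.coprime_div_gcd_div_gcd hg
    have hk : 0 < (((k + 1) / Nat.gcd x (k + 1) : ℕ) : ℤ) :=
      Nat.cast_pos.2 (Nat.div_pos (Nat.gcd_le_right _ (by omega)) hg)
    have e : (x : ℚ) / (k + 1) = (((x / Nat.gcd x (k + 1) : ℕ) : ℤ) : ℚ) /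
        ((((k + 1) / Nat.gcd x (k + 1) : ℕ) : ℤ) : ℚ) := by
      have hg' : (Nat.gcd x (k + 1) : ℚ) ≠ 0 := Nat.cast_ne_zero.2 hg.ne'
      rw [Int.cast_natCast, Int.cast_natCast, Nat.cast_div (Nat.gcd_dvd_left _ _) hg',
        Nat.cast_div (Nat.gcd_dvd_right _ _) hg', div_div_div_cancel_right₀ hg']
      push_cast
      rfl
    rw [e]
    refine ⟨Rat.num_div_eq_of_coprime hk hx, ?_⟩
    exact_mod_cast Rat.den_div_eq_of_coprime hk hx
  split_ifs with h
  · obtain ⟨h1, h2⟩ := key (a - b)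
    rw [Nat.cast_sub h] at h1 h2
    rw [h1, h2]
    rfl
  · have h' : a ≤ b := by omega
    obtain ⟨h1, h2⟩ := key (b - a)
    rw [Nat.cast_sub h'] at h1 h2
    have e : ((a : ℚ) - b) / (k + 1) = -(((b : ℚ) - a) / (k + 1)) := by ring
    rw [e, Rat.num_neg_eq_neg_num, Rat.den_neg_eq_den, h1, h2]
    have hpos : 0 < (b - a) / Nat.gcd (b - a) (k + 1) :=
      Nat.div_pos (Nat.gcd_le_left _ (by omega)) (Nat.gcd_pos_of_pos_right _ (by omega))
    obtain ⟨n, hn⟩ : ∃ n, (b - a) / Nat.gcd (b - a) (k + 1) = n + 1 :=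
      Nat.exists_eq_succ_of_ne_zero hpos.ne'
    rw [hn]
    rfl

/-- Forming the rational number `(a - b) / (k + 1)` from natural numbers is primitive recursive. -/
theorem primrec_sub_div :
    Primrec fun p : ℕ × ℕ × ℕ => ((p.1 : ℚ) - p.2.1) / (p.2.2 + 1) := by
  have hvalid : PrimrecPred fun m : ℕ =>
      0 < m.unpair.2 ∧ Nat.gcd ((m.unpair.1 + 1) / 2) m.unpair.2 = 1 := by
    have h1 : Primrec fun m : ℕ => m.unpair.1 := Primrec.fst.comp Primrec.unpair
    have h2 : Primrec fun m : ℕ => m.unpair.2 := Primrec.snd.comp Primrec.unpair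
    exact (Primrec.nat_lt.comp (Primrec.const 0) h2).and
      (Primrec.eq.comp (primrec_gcd.comp (Primrec.nat_div.comp (Primrec.succ.comp h1)
        (Primrec.const 2)) h2) (Primrec.const 1))
  have ha : Primrec fun p : ℕ × ℕ × ℕ => p.1 := Primrec.fst
  have hb : Primrec fun p : ℕ × ℕ × ℕ => p.2.1 := Primrec.fst.comp Primrec.snd
  have hk : Primrec fun p : ℕ × ℕ × ℕ => p.2.2 + 1 :=
    Primrec.succ.comp (Primrec.snd.comp Primrec.snd)
  have hab := Primrec.nat_sub.comp ha hb
  have hba := Primrec.nat_sub.comp hb ha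
  have hcode : Primrec fun p : ℕ × ℕ × ℕ =>
      if p.2.1 ≤ p.1 then
        Nat.pair (2 * ((p.1 - p.2.1) / Nat.gcd (p.1 - p.2.1) (p.2.2 + 1)))
          ((p.2.2 + 1) / Nat.gcd (p.1 - p.2.1) (p.2.2 + 1))
      else
        Nat.pair (2 * ((p.2.1 - p.1) / Nat.gcd (p.2.1 - p.1) (p.2.2 + 1)) - 1)
          ((p.2.2 + 1) / Nat.gcd (p.2.1 - p.1) (p.2.2 + 1)) := by
    refine Primrec.ite (Primrec.nat_le.comp hb ha) ?_ ?_
    · exact Primrec₂.natPair.comp (Primrec.nat_mul.comp (Primrec.const 2)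
        (Primrec.nat_div.comp hab (primrec_gcd.comp hab hk)))
        (Primrec.nat_div.comp hk (primrec_gcd.comp hab hk))
    · exact Primrec₂.natPair.comp (Primrec.nat_sub.comp (Primrec.nat_mul.comp (Primrec.const 2)
        (Primrec.nat_div.comp hba (primrec_gcd.comp hba hk))) (Primrec.const 1))
        (Primrec.nat_div.comp hk (primrec_gcd.comp hba hk))
  refine Primrec.encode_iff.1 ?_
  refine ((Primrec.list_length.comp ((Primrec.listFilter hvalid).comp
    (Primrec.list_range.comp hcode)))).of_eq fun p => ?_
  exact Eq.symm (by rw [encode_rat_eq, encode_num_sub_div])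

theorem constructive_of_tendsto {g : List Bool → ℝ} {h : List Bool × ℕ → ℚ} (hh : Computable h)
    (hmono : ∀ w n, h (w, n) ≤ h (w, n + 1)) (hlt : ∀ w n, (h (w, n) : ℝ) < g w)
    (hlim : ∀ w, Tendsto (fun n => (h (w, n) : ℝ)) atTop (nhds (g w))) : Constructive g :=
  ⟨h, hh, fun w n => ⟨hmono w n, hlt w n⟩, fun w => tendsto_nhds_unique (hlim w)
    (tendsto_atTop_ciSup
      (monotone_nat_of_le_succ fun n => by exact_mod_cast hmono w n)
      ⟨g w, by rintro _ ⟨n, rfl⟩; exact (hlt w n).le⟩)⟩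

theorem primrec_const_pow (a : ℕ) : Primrec fun n => a ^ n :=
  (Primrec.nat_rec₁ 1 (f := fun _ x => x * a)
    (Primrec.nat_mul.comp Primrec.snd (Primrec.const a))).of_eq fun n => by
      induction n with
      | zero => rfl
      | succ n ih => rw [pow_succ, ← ih]

theorem primrec_preSeq_zeroExt : Primrec₂ fun (v : List Bool) (n : ℕ) => preSeq (zeroExt v) n :=
  Primrec.list_map (Primrec.list_range.comp Primrec.snd)
    ((Primrec.list_getD false).comp (Primrec.fst.comp Primrec.fst) Primrec.snd).to₂

theorem computable_sub_div {α : Type*} [Primcodable α] {a b k : α → ℕ} (ha : Computable a)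
    (hb : Computable b) (hk : Computable k) :
    Computable fun x => ((a x : ℚ) - b x) / (k x + 1) :=
  Computable.comp (f := fun p : ℕ × ℕ × ℕ => ((p.1 : ℚ) - p.2.1) / (p.2.2 + 1))
    (g := fun x => (a x, b x, k x)) primrec_sub_div.to_comp (ha.pair (hb.pair hk))

/-- A set of strings that is the union of a computable increasing sequence of sets. -/
structure Enumerates (r : List Bool × ℕ → Bool) (A : Set (List Bool)) : Prop where
  computable : Computable r
  mono : ∀ v m n, m ≤ n → r (v, m) = true → r (v, n) = true
  mem_iff : ∀ v, v ∈ A ↔ ∃ n, r (v, n) = true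

theorem Constructive.exists_enumerates {d : List Bool → ℝ} (hd : Constructive d) :
    ∃ r, Enumerates r {v | 1 < d v} := by
  obtain ⟨h, hh, hlt, hsup⟩ := hd
  let R : List Bool → ℕ → Bool := fun v t =>
    decide (h (v, t.unpair.1) =
      ((t.unpair.2.unpair.1 + t.unpair.2.unpair.2 + 2 : ℕ) - (0 : ℕ)) / (t.unpair.2.unpair.2 + 1))
  have hR : Computable₂ R := by
    have hu : Computable fun p : List Bool × ℕ => p.2.unpair := Computable.unpair.comp Computable.snd
    have hu2 := Computable.unpair.comp (Computable.snd.comp hu)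
    exact Primrec.eq.decide.to_comp.comp
      (hh.comp (Computable.fst.pair (Computable.fst.comp hu)))
      (computable_sub_div (Computable.succ.comp (Computable.succ.comp
        (Primrec.nat_add.to_comp.comp (Computable.fst.comp hu2) (Computable.snd.comp hu2))))
        (Computable.const 0) (Computable.snd.comp hu2))
  have hR_iff : ∀ v, (∃ t, R v t = true) ↔ ∃ n, 1 < h (v, n) := by
    intro v
    constructor
    · rintro ⟨t, ht⟩
      refine ⟨t.unpair.1, ?_⟩
      rw [of_decide_eq_true ht, lt_div_iff₀ (by positivity)]
      push_cast
      have : (0 : ℚ) ≤ t.unpair.2.unpair.1 := Nat.cast_nonneg _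
      linarith
    · rintro ⟨n, hn⟩
      have hnum : ((h (v, n)).den : ℤ) < (h (v, n)).num := by
        rw [← Rat.num_div_den (h (v, n)), lt_div_iff₀ (by exact_mod_cast (h (v, n)).pos)] at hn
        exact_mod_cast (one_mul ((h (v, n)).den : ℚ)) ▸ hn
      obtain ⟨k, hk⟩ := Nat.exists_eq_succ_of_ne_zero (h (v, n)).den_ne_zero
      obtain ⟨a, ha⟩ : ∃ a : ℕ, (h (v, n)).num = a + k + 2 :=
        ⟨((h (v, n)).num - k - 2).toNat, by omega⟩
      refine ⟨Nat.pair n (Nat.pair a k), decide_eq_true ?_⟩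
      simp only [Nat.unpair_pair]
      conv_lhs => rw [← Rat.num_div_den (h (v, n)), ha, hk]
      push_cast
      ring
  let r : List Bool × ℕ → Bool := fun p => Nat.rec false (fun t acc => acc || R p.1 t) p.2
  have hr_iff : ∀ v n, r (v, n) = true ↔ ∃ t < n, R v t = true := by
    intro v n
    induction n with
    | zero => simp [r]
    | succ n ih =>
      have : r (v, n + 1) = (r (v, n) || R v n) := rfl
      rw [this, Bool.or_eq_true, ih]
      constructor
      · rintro (⟨t, ht, hv⟩ | hv)
        · exact ⟨t, by omega, hv⟩
        · exact ⟨n, by omega, hv⟩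
      · rintro ⟨t, ht, hv⟩
        rcases Nat.lt_succ_iff_lt_or_eq.1 ht with h | rfl
        · exact Or.inl ⟨t, h, hv⟩
        · exact Or.inr hv
  refine ⟨r, ?_, ?_, ?_⟩
  · exact Computable.nat_rec Computable.snd (Computable.const false)
      (Primrec.or.to_comp.comp (Computable.snd.comp Computable.snd)
        (hR.comp (Computable.fst.comp Computable.fst) (Computable.fst.comp Computable.snd))).to₂
  · intro v m n hmn
    rw [hr_iff, hr_iff]
    exact fun ⟨t, ht, hv⟩ => ⟨t, ht.trans_le hmn, hv⟩
  · intro v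
    have h1 : (1 < d v) ↔ ∃ n, 1 < h (v, n) := by
      constructor
      · intro hv
        rw [hsup v] at hv
        obtain ⟨n, hn⟩ := exists_lt_of_lt_ciSup hv
        exact ⟨n, by exact_mod_cast hn⟩
      · rintro ⟨n, hn⟩
        have : (1 : ℝ) < h (v, n) := by exact_mod_cast hn
        exact this.trans (hlt v n).2
    rw [Set.mem_ofPred_eq, h1, ← hR_iff]
    constructor
    · rintro ⟨t, ht⟩
      exact ⟨t + 1, (hr_iff _ _).2 ⟨t, t.lt_succ_self, ht⟩⟩
    · rintro ⟨n, hn⟩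
      obtain ⟨t, -, ht⟩ := (hr_iff _ _).1 hn
      exact ⟨t, ht⟩

/-- Iterated addition of fractions, without reduction to lowest terms. -/
def fracSum (f : ℕ → ℕ × ℕ) : ℕ → ℕ × ℕ :=
  Nat.rec (0, 1) fun i acc => (acc.1 * (f i).2 + (f i).1 * acc.2, acc.2 * (f i).2)

theorem fracSum_pos {f : ℕ → ℕ × ℕ} (hf : ∀ i, 0 < (f i).2) (n : ℕ) : 0 < (fracSum f n).2 := by
  induction n with
  | zero => exact Nat.one_pos
  | succ n ih => exact Nat.mul_pos ih (hf n)

theorem fracSum_div {f : ℕ → ℕ × ℕ} (hf : ∀ i, 0 < (f i).2) (n : ℕ) :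
    ((fracSum f n).1 : ℝ) / (fracSum f n).2 =
      ∑ i ∈ Finset.range n, ((f i).1 : ℝ) / (f i).2 := by
  induction n with
  | zero => simp [fracSum]
  | succ n ih =>
    have h1 : ((fracSum f n).2 : ℝ) ≠ 0 := Nat.cast_ne_zero.2 (fracSum_pos hf n).ne'
    have h2 : ((f n).2 : ℝ) ≠ 0 := Nat.cast_ne_zero.2 (hf n).ne'
    have e : fracSum f (n + 1) = ((fracSum f n).1 * (f n).2 + (f n).1 * (fracSum f n).2,
      (fracSum f n).2 * (f n).2) := rfl
    rw [Finset.sum_range_succ, ← ih, e, div_add_div _ _ h1 h2]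
    push_cast
    ring

theorem computable_fracSum {α : Type*} [Primcodable α] {f : α → ℕ → ℕ × ℕ} {n : α → ℕ}
    (hf : Computable₂ f) (hn : Computable n) : Computable fun a => fracSum (f a) (n a) := by
  have hacc : Computable fun p : α × ℕ × (ℕ × ℕ) => p.2.2 := Computable.snd.comp Computable.snd
  have hfi : Computable fun p : α × ℕ × (ℕ × ℕ) => f p.1 p.2.1 :=
    hf.comp Computable.fst (Computable.fst.comp Computable.snd)
  have hmul := Primrec.nat_mul.to_comp
  exact Computable.nat_rec hn (Computable.const (0, 1))
    ((Primrec.nat_add.to_comp.comp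
      (hmul.comp (Computable.fst.comp hacc) (Computable.snd.comp hfi))
      (hmul.comp (Computable.fst.comp hfi) (Computable.snd.comp hacc))).pair
      (hmul.comp (Computable.snd.comp hacc) (Computable.snd.comp hfi))).to₂

theorem constructive_massGale {r : List Bool × ℕ → Bool} {A : Set (List Bool)}
    (hr : Enumerates r A) {B D C E : ℕ} (hB : 0 < B) (hE : 0 < E)
    (hω : Summable (A.indicator fun v => (((B : ℝ) / D) ^ v.length)⁻¹)) :
    Constructive (massGale ((C : ℝ) / E) (A.indicator fun v => (((B : ℝ) / D) ^ v.length)⁻¹)) := by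
  classical
  set ω : List Bool → ℝ := A.indicator fun v => (((B : ℝ) / D) ^ v.length)⁻¹ with hω_def
  have h0 : ∀ v, 0 ≤ ω v := fun v => Set.indicator_nonneg (fun v _ => by positivity) v
  let body : (List Bool × ℕ) → List Bool → ℕ × ℕ := fun p v =>
    bif r (v, p.2) && decide (preSeq (zeroExt v) p.1.length = p.1) then
      (D ^ v.length, B ^ v.length) else (0, 1)
  let term : (List Bool × ℕ) → ℕ → ℕ × ℕ := fun p i =>
    ((Encodable.decode₂ (List Bool) i).map (body p)).getD (0, 1)
  let P : (List Bool × ℕ) → ℕ × ℕ := fun p => fracSum (term p) p.2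
  let h : (List Bool × ℕ) → ℚ := fun p =>
    (((P p).1 * C ^ p.1.length * (p.2 + 1) : ℕ) - ((P p).2 * E ^ p.1.length : ℕ)) /
      (((P p).2 * E ^ p.1.length * (p.2 + 1) - 1 : ℕ) + 1)
  have hbody : Computable₂ body := by
    have hpow (a : ℕ) : Computable fun q : (List Bool × ℕ) × List Bool => a ^ q.2.length :=
      ((primrec_const_pow a).comp (Primrec.list_length.comp Primrec.snd)).to_comp
    have hext : Primrec fun q : (List Bool × ℕ) × List Bool =>
        decide (preSeq (zeroExt q.2) q.1.1.length = q.1.1) :=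
      have hw : Primrec fun q : (List Bool × ℕ) × List Bool => q.1.1 :=
        Primrec.fst.comp Primrec.fst
      Primrec.eq.decide.comp
        (primrec_preSeq_zeroExt.comp Primrec.snd (Primrec.list_length.comp hw)) hw
    exact Computable.cond (Primrec.and.to_comp.comp
      (hr.computable.comp (Computable.snd.pair (Computable.snd.comp Computable.fst))) hext.to_comp)
      ((hpow D).pair (hpow B)) (Computable.const (0, 1))
  have hterm : Computable₂ term := Computable.option_getD
    (Computable.option_map (Primrec.decode₂.to_comp.comp Computable.snd)
      (hbody.comp (Computable.fst.comp Computable.fst) Computable.snd).to₂)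
    (Computable.const (0, 1))
  have hh : Computable h := by
    have hP : Computable P := computable_fracSum hterm Computable.snd
    have hmul := Primrec.nat_mul.to_comp
    have hn : Computable fun p : List Bool × ℕ => p.2 + 1 := Computable.succ.comp Computable.snd
    have hpow (a : ℕ) : Computable fun p : List Bool × ℕ => a ^ p.1.length :=
      ((primrec_const_pow a).comp (Primrec.list_length.comp Primrec.fst)).to_comp
    have hQ := hmul.comp (Computable.snd.comp hP) (hpow E)
    exact computable_sub_div (hmul.comp (hmul.comp (Computable.fst.comp hP) (hpow C)) hn) hQ
      (Computable.pred.comp (hmul.comp hQ hn))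
  have hterm_pos : ∀ p i, 0 < (term p i).2 := by
    intro p i
    simp only [term]
    rcases Encodable.decode₂ (List Bool) i with - | v
    · simp
    · simp only [Option.map_some, Option.getD_some, body]
      cases r (v, p.2) && decide (preSeq (zeroExt v) p.1.length = p.1)
      · simp
      · simpa using Nat.pow_pos hB
  let t : (List Bool × ℕ) → ℕ → ℝ := fun p i => ((term p i).1 : ℝ) / (term p i).2
  have hval : ∀ w n, (h (w, n) : ℝ) =
      ((C : ℝ) / E) ^ w.length * ∑ i ∈ Finset.range n, t (w, n) i - 1 / (n + 1) := by
    intro w n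
    have hPpos : 0 < (P (w, n)).2 := fracSum_pos (hterm_pos _) n
    have hpos : 1 ≤ (P (w, n)).2 * E ^ w.length * (n + 1) :=
      Nat.mul_pos (Nat.mul_pos hPpos (Nat.pow_pos hE)) n.succ_pos
    have h1 : ((P (w, n)).2 : ℝ) ≠ 0 := Nat.cast_ne_zero.2 hPpos.ne'
    have h2 : (E : ℝ) ≠ 0 := Nat.cast_ne_zero.2 hE.ne'
    have h3 : (n : ℝ) + 1 ≠ 0 := by positivity
    rw [← fracSum_div (hterm_pos (w, n)) n]
    change _ = _ * (((P (w, n)).1 : ℝ) / (P (w, n)).2) - _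
    simp only [h]
    rw [Nat.cast_sub hpos]
    push_cast
    rw [sub_add_cancel, div_pow]
    field_simp
  let G : List Bool → List Bool → ℝ := fun w v =>
    if preSeq (zeroExt v) w.length = w then ω v else 0
  let τ : List Bool → ℕ → ℝ := fun w => Function.extend Encodable.encode (G w) 0
  have hτ_summable : ∀ w, Summable (τ w) := fun w =>
    (summable_extend_zero Encodable.encode_injective).2 (summable_ite_of_nonneg h0 hω _)
  have hτ_tsum : ∀ w, ∑' i, τ w i = ∑' v, G w v := fun w =>
    tsum_extend_zero Encodable.encode_injective _
  have ht_none : ∀ w i, Encodable.decode₂ (List Bool) i = none →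
      τ w i = 0 ∧ ∀ n, t (w, n) i = 0 := by
    intro w i hi
    refine ⟨Function.extend_apply' _ _ _ ?_, fun n => by simp [t, term, hi]⟩
    rintro ⟨v, rfl⟩
    simp at hi
  have ht_some : ∀ w i v, Encodable.decode₂ (List Bool) i = some v →
      τ w i = G w v ∧ ∀ n, t (w, n) i =
        if r (v, n) = true ∧ preSeq (zeroExt v) w.length = w then
          (((B : ℝ) / D) ^ v.length)⁻¹ else 0 := by
    intro w i v hi
    refine ⟨?_, fun n => ?_⟩
    · rw [← Encodable.mem_decode₂.1 hi]
      exact Encodable.encode_injective.extend_apply _ _ _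
    · simp only [t, term, hi, Option.map_some, Option.getD_some, body]
      by_cases h1 : r (v, n) = true <;> by_cases h2 : preSeq (zeroExt v) w.length = w <;>
        simp [h1, h2, div_pow]
  have ht_nonneg : ∀ p i, 0 ≤ t p i := fun p i => by positivity
  have ht_mono : ∀ w m n i, m ≤ n → t (w, m) i ≤ t (w, n) i := by
    intro w m n i hmn
    rcases hi : Encodable.decode₂ (List Bool) i with - | v
    · rw [(ht_none w i hi).2, (ht_none w i hi).2]
    · rw [(ht_some w i v hi).2, (ht_some w i v hi).2]
      by_cases hm : r (v, m) = true
      · simp [hm, hr.mono v m n hmn hm]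
      · simp only [hm, false_and, if_false, Bool.false_eq_true]
        split_ifs <;> positivity
  have ht_eventually : ∀ w i, (∀ n, t (w, n) i ≤ τ w i) ∧ ∃ n, t (w, n) i = τ w i := by
    intro w i
    rcases hi : Encodable.decode₂ (List Bool) i with - | v
    · simp [(ht_none w i hi).2, (ht_none w i hi).1]
    · simp only [(ht_some w i v hi).2, (ht_some w i v hi).1, G]
      by_cases hv : v ∈ A
      · rw [hω_def, Set.indicator_of_mem hv]
        refine ⟨fun n => ?_, ?_⟩
        · by_cases h1 : r (v, n) = true <;> by_cases h2 : preSeq (zeroExt v) w.length = w <;>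
            simp only [h1, h2, and_self, and_true, and_false, if_true, if_false, le_refl,
              Bool.false_eq_true]
          positivity
        · obtain ⟨n, hn⟩ := (hr.mem_iff v).1 hv
          exact ⟨n, by simp [hn]⟩
      · have hrv : ∀ n, ¬ r (v, n) = true := fun n hn => hv ((hr.mem_iff v).2 ⟨n, hn⟩)
        rw [hω_def, Set.indicator_of_notMem hv]
        simp [hrv]
  have hsum_le : ∀ w n, ∑ i ∈ Finset.range n, t (w, n) i ≤ ∑' v, G w v := by
    intro w n
    rw [← hτ_tsum w]
    refine (Finset.sum_le_sum fun i _ => (ht_eventually w i).1 n).trans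
      ((hτ_summable w).sum_le_tsum _ fun i _ => ?_)
    exact (ht_nonneg (w, 0) i).trans ((ht_eventually w i).1 0)
  have hsum_lim : ∀ w, Tendsto (fun n => ∑ i ∈ Finset.range n, t (w, n) i) atTop
      (nhds (∑' v, G w v)) := by
    intro w
    rw [← hτ_tsum w]
    have hdom := tendsto_tsum_of_dominated_convergence (𝓕 := atTop)
      (f := fun n i => if i ∈ Finset.range n then t (w, n) i else 0) (g := τ w) (hτ_summable w)
      (fun i => by
        obtain ⟨m, hm⟩ := (ht_eventually w i).2
        refine tendsto_const_nhds.congr' ?_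
        filter_upwards [eventually_ge_atTop m, eventually_gt_atTop i] with n hmn hin
        rw [if_pos (Finset.mem_range.2 hin)]
        exact le_antisymm (hm ▸ ht_mono w m n i hmn) ((ht_eventually w i).1 n))
      (Eventually.of_forall fun n i => by
        rw [Real.norm_of_nonneg (by split_ifs <;> simp [ht_nonneg])]
        split_ifs
        · exact (ht_eventually w i).1 n
        · exact (ht_nonneg (w, 0) i).trans ((ht_eventually w i).1 0))
    refine hdom.congr fun n => ?_
    rw [tsum_eq_sum (s := Finset.range n) fun i hi => if_neg hi]
    exact Finset.sum_congr rfl fun i hi => if_pos hi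
  have hc : ∀ w : List Bool, 0 ≤ ((C : ℝ) / E) ^ w.length := fun w => by positivity
  refine constructive_of_tendsto hh (fun w n => ?_) (fun w n => ?_) fun w => ?_
  · have hle : (h (w, n) : ℝ) ≤ h (w, n + 1) := by
      rw [hval, hval]
      refine sub_le_sub (mul_le_mul_of_nonneg_left ?_ (hc w)) ?_
      · rw [Finset.sum_range_succ]
        exact le_add_of_le_of_nonneg
          (Finset.sum_le_sum fun i _ => ht_mono w n (n + 1) i n.le_succ) (ht_nonneg _ _)
      · push_cast
        gcongr
        linarith
    exact_mod_cast hle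
  · rw [hval]
    exact (sub_lt_self _ (by positivity)).trans_le (mul_le_mul_of_nonneg_left (hsum_le w n) (hc w))
  · simp only [hval]
    have hlim := ((hsum_lim w).const_mul (((C : ℝ) / E) ^ w.length)).sub
      (tendsto_one_div_add_atTop_nhds_zero_nat (𝕜 := ℝ))
    rwa [sub_zero] at hlim

theorem exists_constructive_gale_univ :
    ∃ d : List Bool → ℝ, Gale 2 d ∧ Constructive d ∧ SuccessSet d = Set.univ := by
  refine ⟨fun w => 2 ^ w.length, ⟨fun w => by positivity, fun w => ?_⟩, ?_, ?_⟩
  · simp only [List.length_append, List.length_singleton, pow_succ]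
    norm_num
    ring
  · let h : List Bool × ℕ → ℚ := fun p =>
      ((2 ^ p.1.length * (p.2 + 1) : ℕ) - (1 : ℕ)) / ((p.2 : ℕ) + 1)
    have hval : ∀ w n, (h (w, n) : ℝ) = 2 ^ w.length - 1 / (n + 1) := by
      intro w n
      simp only [h]
      push_cast
      field_simp
    refine constructive_of_tendsto (h := h) ?_ (fun w n => ?_) (fun w n => ?_) fun w => ?_
    · exact computable_sub_div (Primrec.nat_mul.to_comp.comp
        ((primrec_const_pow 2).comp (Primrec.list_length.comp Primrec.fst)).to_comp
        (Computable.succ.comp Computable.snd)) (Computable.const 1) Computable.snd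
    · have hle : (h (w, n) : ℝ) ≤ h (w, n + 1) := by
        rw [hval, hval]
        push_cast
        gcongr
        linarith
      exact_mod_cast hle
    · rw [hval]
      exact sub_lt_self _ (by positivity)
    · simp only [hval]
      simpa using (tendsto_const_nhds (x := (2 : ℝ) ^ w.length)).sub
        (tendsto_one_div_add_atTop_nhds_zero_nat (𝕜 := ℝ))
  · refine Set.eq_univ_of_forall fun S => ?_
    have hlim : Tendsto (fun n => (((2 : ℝ) ^ (preSeq S n).length : ℝ) : EReal)) atTop
        (nhds ⊤) := by
      simp only [length_preSeq]
      exact EReal.tendsto_coe_atTop.comp (tendsto_pow_atTop_atTop_of_one_lt one_lt_two)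
    exact hlim.limsup_eq

theorem exists_div_between {x y : ℝ} (hx : 0 < x) (hxy : x < y) :
    ∃ p q : ℕ, 0 < p ∧ 0 < q ∧ x < (p : ℝ) / q ∧ (p : ℝ) / q < y := by
  obtain ⟨b, hxb, hby⟩ := exists_rat_btwn hxy
  have hb : 0 < b := by exact_mod_cast hx.trans hxb
  have e : ((b.num.toNat : ℕ) : ℝ) / b.den = b := by
    have : ((b.num.toNat : ℕ) : ℤ) = b.num := Int.toNat_of_nonneg (Rat.num_nonneg.2 hb.le)
    rw [← Int.cast_natCast, this, ← Rat.cast_def]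
  exact ⟨b.num.toNat, b.den, by have := Rat.num_pos.2 hb; omega, b.pos, by rwa [e], by rwa [e]⟩

/-- A constructive supergale can be replaced by a constructive gale with an arbitrarily close
larger exponent. -/
theorem Supergale.exists_constructive_gale {s s' : ℝ} (hs : 0 ≤ s) (hss' : s < s')
    {d : List Bool → ℝ} (hd : Supergale s d) (hc : Constructive d) :
    ∃ u, 0 ≤ u ∧ u < s' ∧ ∃ g, Gale u g ∧ Constructive g ∧ SuccessSet d ⊆ SuccessSet g := by
  obtain ⟨r, hr⟩ := hc.exists_enumerates
  obtain ⟨C, E, hC, hE, hsc, hcu⟩ := exists_div_between (x := 2 ^ s) (by positivity)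
    (Real.rpow_lt_rpow_of_exponent_lt one_lt_two hss')
  obtain ⟨B, D, hB, hD, hsb, hbc⟩ := exists_div_between (by positivity) hsc
  have hb0 : (0 : ℝ) < B / D := by positivity
  have hc0 : (0 : ℝ) < C / E := by positivity
  have h0 : ∀ v, 0 ≤ ({v | 1 < d v} : Set (List Bool)).indicator
      (fun v => (((B : ℝ) / D) ^ v.length)⁻¹) v :=
    fun v => Set.indicator_nonneg (fun v _ => by positivity) v
  have hω : Summable (({v | 1 < d v} : Set (List Bool)).indicator
      fun v => (((B : ℝ) / D) ^ v.length)⁻¹) := by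
    refine (hd.summable_div_pow hsb).of_nonneg_of_le h0 fun v => ?_
    by_cases hv : 1 < d v
    · rw [Set.indicator_of_mem (s := {v | 1 < d v}) hv, inv_eq_one_div]
      gcongr
    · rw [Set.indicator_of_notMem (s := {v | 1 < d v}) hv]
      exact div_nonneg (hd.1 v) (by positivity)
  refine ⟨Real.logb 2 (C / E), ?_, ?_, _, gale_massGale hc0 h0 hω,
    constructive_massGale hr hB hE hω, successSet_massGale hb0 hbc h0 hω fun v hv =>
      Set.indicator_of_mem (s := {v | 1 < d v}) hv _⟩
  · exact Real.logb_nonneg one_lt_two ((Real.one_le_rpow one_le_two hs).trans hsc.le)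
  · exact (Real.logb_lt_iff_lt_rpow one_lt_two hc0).2 hcu

/-- Constructive dimension can be equivalently defined with gales:
`cdim X = inf Ĝ_constr(X) = inf G_constr(X)`. -/
theorem cdim_eq_inf_gales (X : Set (ℕ → Bool)) :
    sInf {s : ℝ | 0 ≤ s ∧ ∃ d : List Bool → ℝ,
        Supergale s d ∧ Constructive d ∧ X ⊆ SuccessSet d}
      = sInf {s : ℝ | 0 ≤ s ∧ ∃ d : List Bool → ℝ,
        Gale s d ∧ Constructive d ∧ X ⊆ SuccessSet d} := by
  have hbdd : ∀ p : ℝ → Prop, BddBelow {s : ℝ | 0 ≤ s ∧ p s} := fun p => ⟨0, fun s hs => hs.1⟩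
  have hsub : {s : ℝ | 0 ≤ s ∧ ∃ d : List Bool → ℝ, Gale s d ∧ Constructive d ∧ X ⊆ SuccessSet d} ⊆
      {s : ℝ | 0 ≤ s ∧ ∃ d : List Bool → ℝ, Supergale s d ∧ Constructive d ∧ X ⊆ SuccessSet d} :=
    fun s ⟨hs, d, hd, h⟩ => ⟨hs, d, ⟨hd.1, fun w => (hd.2 w).ge⟩, h⟩
  have hne : {s : ℝ | 0 ≤ s ∧ ∃ d : List Bool → ℝ,
      Gale s d ∧ Constructive d ∧ X ⊆ SuccessSet d}.Nonempty := by
    obtain ⟨d, hd, hc, hS⟩ := exists_constructive_gale_univ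
    exact ⟨2, zero_le_two, d, hd, hc, hS ▸ Set.subset_univ X⟩
  refine le_antisymm (csInf_le_csInf (hbdd _) hne hsub) (le_csInf (hne.mono hsub) ?_)
  rintro s ⟨hs, d, hd, hc, hX⟩
  refine le_of_forall_gt_imp_ge_of_dense fun s' hss' => ?_
  obtain ⟨u, hu, hus', g, hg, hgc, hdg⟩ := hd.exists_constructive_gale hs hss' hc
  exact (csInf_le (hbdd _) ⟨hu, g, hg, hgc, hX.trans hdg⟩).trans hus'.le
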